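/- Let G be a simple graph on {1,…,n} such that E_G is finite-dimensional, and let d₀ be the largest d with E_G^{d₀} ≠ 0. Then for every nonzero Q ∈ E_G there exists P ∈ E_G, a product of generators x_{ij} with {i,j} edges of G, such that PQ is nonzero and PQ ∈ E_G^{d₀}. -/

import Mathlib

open scoped TensorProduct

namespace FK

/-- Defining relations of the Fomin–Kirillov algebra `E n`, with generators indexed by
ordered pairs `(i, j)`; we also impose `x_{ii} = 0` and the antisymmetry `x_{ji} = -x_{ij}`,
so that the generators of the algebra are the `x_{ij}` for `i < j`. -/
inductive Rel (n : ℕ) : FreeAlgebra ℚ (Fin n × Fin n) → FreeAlgebra ℚ (Fin n × Fin n) → Prop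
  | diag (i : Fin n) : Rel n (FreeAlgebra.ι ℚ (i, i)) 0
  | antisymm (i j : Fin n) (hij : i ≠ j) :
      Rel n (FreeAlgebra.ι ℚ (j, i)) (-FreeAlgebra.ι ℚ (i, j))
  | square (i j : Fin n) (hij : i ≠ j) :
      Rel n (FreeAlgebra.ι ℚ (i, j) * FreeAlgebra.ι ℚ (i, j)) 0
  | comm (i j k l : Fin n) (h : List.Nodup [i, j, k, l]) :
      Rel n (FreeAlgebra.ι ℚ (i, j) * FreeAlgebra.ι ℚ (k, l))
        (FreeAlgebra.ι ℚ (k, l) * FreeAlgebra.ι ℚ (i, j))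
  | cyclic (i j k : Fin n) (h : List.Nodup [i, j, k]) :
      Rel n (FreeAlgebra.ι ℚ (i, j) * FreeAlgebra.ι ℚ (j, k)
        + FreeAlgebra.ι ℚ (j, k) * FreeAlgebra.ι ℚ (k, i)
        + FreeAlgebra.ι ℚ (k, i) * FreeAlgebra.ι ℚ (i, j)) 0

/-- The Fomin–Kirillov algebra `E n`. -/
abbrev E (n : ℕ) : Type := RingQuot (Rel n)

/-- The generator `x_{ij}` of `E n`. -/
noncomputable def x (n : ℕ) (i j : Fin n) : E n :=
  RingQuot.mkAlgHom ℚ (Rel n) (FreeAlgebra.ι ℚ (i, j))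

/-- The product of generators `x_{i₁j₁} ⋯ x_{i_d j_d}` given by a list of pairs. -/
noncomputable def word (n : ℕ) (l : List (Fin n × Fin n)) : E n :=
  (l.map fun p => x n p.1 p.2).prod

/-- The degree-`d` component of `E n`: the span of products of `d` generators. -/
def degSpan (n : ℕ) (d : ℕ) : Submodule ℚ (E n) :=
  Submodule.span ℚ {y | ∃ l : List (Fin n × Fin n),
    (∀ p ∈ l, p.1 ≠ p.2) ∧ l.length = d ∧ y = word n l}

/-- The Fomin–Kirillov algebra of a graph `G`: the subalgebra of `E n` generated by the
`x_{ij}` with `{i,j}` an edge of `G`. -/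
def EG (n : ℕ) (G : SimpleGraph (Fin n)) : Subalgebra ℚ (E n) :=
  Algebra.adjoin ℚ {y | ∃ i j : Fin n, G.Adj i j ∧ y = x n i j}

/-- The degree-`d` component `E_G^d = E_G ∩ E_n^d`. -/
def EGdeg (n : ℕ) (G : SimpleGraph (Fin n)) (d : ℕ) : Submodule ℚ (E n) :=
  (EG n G).toSubmodule ⊓ degSpan n d

/-- The positive-degree part `E_G⁺` of `E_G`. -/
def EGplus (n : ℕ) (G : SimpleGraph (Fin n)) : Submodule ℚ (E n) :=
  ⨆ d : ℕ, ⨆ _ : 1 ≤ d, EGdeg n G d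


lemma mk_rel {n : ℕ} {a b : FreeAlgebra ℚ (Fin n × Fin n)} (h : Rel n a b) :
    RingQuot.mkAlgHom ℚ (Rel n) a = RingQuot.mkAlgHom ℚ (Rel n) b :=
  RingQuot.mkAlgHom_rel ℚ h

lemma x_diag (n : ℕ) (i : Fin n) : x n i i = 0 := by
  have := mk_rel (Rel.diag i)
  simpa [x] using this

lemma x_anti (n : ℕ) (i j : Fin n) : x n j i = -x n i j := by
  by_cases h : i = j
  · subst h; simp [x_diag]
  · have := mk_rel (Rel.antisymm i j h)
    simpa [x] using this

lemma add_ns {M : Type} [AddCommMonoid M] [Module ℚ M] (a : M) : a + (-1 : ℚ) • a = 0 := by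
  nth_rewrite 1 [← one_smul ℚ a]
  rw [← add_smul]
  simp

lemma x_anti' (n : ℕ) (i j : Fin n) : x n j i = (-1 : ℚ) • x n i j := by
  rw [x_anti n i j]
  exact neg_eq_of_add_eq_zero_right (add_ns _)

lemma x_sq (n : ℕ) (i j : Fin n) : x n i j * x n i j = 0 := by
  by_cases h : i = j
  · subst h; simp [x_diag]
  · have := mk_rel (Rel.square i j h)
    simpa [x] using this

lemma x_comm (n : ℕ) (i j k l : Fin n) (h : List.Nodup [i, j, k, l]) :
    x n i j * x n k l = x n k l * x n i j := by
  have := mk_rel (Rel.comm i j k l h)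
  simpa [x] using this

lemma x_cyc (n : ℕ) (i j k : Fin n) (h : List.Nodup [i, j, k]) :
    x n i j * x n j k + x n j k * x n k i + x n k i * x n i j = 0 := by
  have := mk_rel (Rel.cyclic i j k h)
  simpa [x] using this

/-- Universal property of `E n`. -/
lemma exists_lift (n : ℕ) {A : Type} [Semiring A] [Algebra ℚ A] (f : Fin n → Fin n → A)
    (h1 : ∀ i, f i i = 0) (h2 : ∀ i j, i ≠ j → f j i + f i j = 0)
    (h3 : ∀ i j, i ≠ j → f i j * f i j = 0)
    (h4 : ∀ i j k l, List.Nodup [i, j, k, l] → f i j * f k l = f k l * f i j)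
    (h5 : ∀ i j k, List.Nodup [i, j, k] →
      f i j * f j k + f j k * f k i + f k i * f i j = 0) :
    ∃ F : E n →ₐ[ℚ] A, ∀ i j, F (x n i j) = f i j := by
  refine ⟨RingQuot.liftAlgHom ℚ ⟨FreeAlgebra.lift ℚ (fun p => f p.1 p.2), ?_⟩, ?_⟩
  · intro a b hab
    cases hab with
    | diag i => simpa using h1 i
    | antisymm i j hij =>
      set F := FreeAlgebra.lift ℚ (fun p : Fin n × Fin n => f p.1 p.2) with hF
      have e1 : F (FreeAlgebra.ι ℚ (i, j)) + F (-FreeAlgebra.ι ℚ (i, j)) = 0 := by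
        rw [← map_add, add_neg_cancel, map_zero]
      have e2 : F (FreeAlgebra.ι ℚ (j, i)) + F (FreeAlgebra.ι ℚ (i, j)) = 0 := by
        simpa [hF] using h2 i j hij
      rw [← add_zero (F (FreeAlgebra.ι ℚ (j, i))), ← e1, ← add_assoc, e2, zero_add]
    | square i j hij => simpa using h3 i j hij
    | comm i j k l h => simpa using h4 i j k l h
    | cyclic i j k h => simpa using h5 i j k h
  · intro i j
    simp [x]

lemma exists_perm (n : ℕ) (s : Equiv.Perm (Fin n)) :
    ∃ F : E n →ₐ[ℚ] E n, ∀ i j, F (x n i j) = x n (s i) (s j) := by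
  apply exists_lift n (fun i j => x n (s i) (s j))
  · intro i; exact x_diag n _
  · intro i j _; simp only [x_anti n (s i) (s j)]; exact neg_add_cancel _
  · intro i j _; exact x_sq n _ _
  · intro i j k l h; exact x_comm n _ _ _ _ (by simpa using h)
  · intro i j k h; exact x_cyc n _ _ _ (by simpa using h)

/-- The action of a permutation on `E n`. -/
noncomputable def act (n : ℕ) (s : Equiv.Perm (Fin n)) : E n →ₐ[ℚ] E n :=
  (exists_perm n s).choose

lemma act_x (n : ℕ) (s : Equiv.Perm (Fin n)) (i j : Fin n) :
    act n s (x n i j) = x n (s i) (s j) := (exists_perm n s).choose_spec i j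

lemma hom_ext {n : ℕ} {A : Type} [Ring A] [Algebra ℚ A] {f g : E n →ₐ[ℚ] A}
    (h : ∀ i j, f (x n i j) = g (x n i j)) : f = g := by
  apply RingQuot.ringQuot_ext'
  apply FreeAlgebra.hom_ext
  funext p
  exact h p.1 p.2

/-- The action of a permutation, as an element of the endomorphism algebra. -/
noncomputable def sg (n : ℕ) (s : Equiv.Perm (Fin n)) : Module.End ℚ (E n) :=
  (act n s).toLinearMap

/-- Left multiplication. -/
noncomputable def Lm (n : ℕ) : E n →ₐ[ℚ] Module.End ℚ (E n) := Algebra.lmul ℚ (E n)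

lemma sg_mul (n : ℕ) (s t : Equiv.Perm (Fin n)) : sg n s * sg n t = sg n (s * t) := by
  have : (act n s).comp (act n t) = act n (s * t) := by
    apply hom_ext
    intro i j
    simp [act_x]
  ext y
  simpa [sg] using congrArg (fun f => f y) this

lemma sg_one (n : ℕ) : sg n 1 = 1 := by
  have : act n 1 = AlgHom.id ℚ _ := by
    apply hom_ext
    intro i j
    simp [act_x]
  ext y
  simp [sg, this]

lemma sg_Lm (n : ℕ) (s : Equiv.Perm (Fin n)) (i j : Fin n) :
    sg n s * Lm n (x n i j) = Lm n (x n (s i) (s j)) * sg n s := by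
  ext y
  simp [sg, Lm, act_x]

/-- Image of `x_{ij}` under the coproduct. -/
noncomputable def D (n : ℕ) (i j : Fin n) : Module.End ℚ (E n) ⊗[ℚ] E n :=
  Lm n (x n i j) ⊗ₜ 1 + sg n (Equiv.swap i j) ⊗ₜ x n i j

lemma D_mul (n : ℕ) (i j k l : Fin n) : D n i j * D n k l =
    (Lm n (x n i j * x n k l)) ⊗ₜ 1
    + (Lm n (x n i j) * sg n (Equiv.swap k l)) ⊗ₜ x n k l
    + (Lm n (x n (Equiv.swap i j k) (Equiv.swap i j l)) * sg n (Equiv.swap i j)) ⊗ₜ x n i j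
    + sg n (Equiv.swap i j * Equiv.swap k l) ⊗ₜ (x n i j * x n k l) := by
  simp only [D, mul_add, add_mul, Algebra.TensorProduct.tmul_mul_tmul, one_mul, mul_one,
    sg_Lm, sg_mul, map_mul]
  abel

lemma shuffle {M : Type} [AddCommMonoid M] {a1 a2 a3 b1 b2 b3 c1 c2 c3 d1 d2 d3 : M}
    (ha : a1 + a2 + a3 = 0) (hb : b1 + b2 + b3 = 0) (h1 : c1 + d1 = 0) (h2 : c2 + d2 = 0)
    (h3 : c3 + d3 = 0) :
    (a1 + c1 + d3 + b1) + (a2 + c2 + d1 + b2) + (a3 + c3 + d2 + b3) = 0 := by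
  have : (a1 + c1 + d3 + b1) + (a2 + c2 + d1 + b2) + (a3 + c3 + d2 + b3) =
      (a1 + a2 + a3) + (b1 + b2 + b3) + (c1 + d1) + (c2 + d2) + (c3 + d3) := by abel
  rw [this, ha, hb, h1, h2, h3]
  simp

lemma exists_cop (n : ℕ) : ∃ F : E n →ₐ[ℚ] Module.End ℚ (E n) ⊗[ℚ] E n,
    ∀ i j, F (x n i j) = D n i j := by
  apply exists_lift
  · intro i; simp [D, x_diag]
  · intro i j _
    have : D n j i = (-1 : ℚ) • D n i j := by
      simp only [D, x_anti' n i j, Equiv.swap_comm j i, map_smul, ← TensorProduct.smul_tmul',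
        TensorProduct.tmul_smul, smul_add]
    rw [this, add_comm, add_ns]
  · intro i j _
    rw [D_mul]
    rw [Equiv.swap_apply_left, Equiv.swap_apply_right, x_sq, x_anti' n i j, map_smul,
      smul_mul_assoc, ← TensorProduct.smul_tmul', map_zero, TensorProduct.zero_tmul,
      TensorProduct.tmul_zero, zero_add, add_zero, add_ns]
  · intro i j k l h
    rw [D_mul, D_mul, x_comm n i j k l h]
    simp only [List.nodup_cons, List.mem_cons, List.not_mem_nil, not_or, or_false] at h
    obtain ⟨⟨h1, h2, h3⟩, ⟨h4, h5⟩, h6, -⟩ := h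
    rw [Equiv.swap_apply_of_ne_of_ne (Ne.symm h2) (Ne.symm h4),
      Equiv.swap_apply_of_ne_of_ne (Ne.symm h3) (Ne.symm h5),
      Equiv.swap_apply_of_ne_of_ne h2 h3, Equiv.swap_apply_of_ne_of_ne h4 h5]
    have : Equiv.swap i j * Equiv.swap k l = Equiv.swap k l * Equiv.swap i j := by
      apply Equiv.Perm.Disjoint.commute
      intro a
      simp only [Equiv.swap_apply_def]
      grind
    rw [this]
    abel
  · intro i j k h
    have hc := x_cyc n i j k h
    rw [D_mul, D_mul, D_mul]
    simp only [List.nodup_cons, List.mem_cons, List.not_mem_nil, not_or, or_false] at h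
    obtain ⟨⟨h1, h2⟩, h3, -⟩ := h
    have e1 : Equiv.swap j k * Equiv.swap k i = Equiv.swap i j * Equiv.swap j k := by
      ext a; simp only [Equiv.Perm.mul_apply, Equiv.swap_apply_def]; grind
    have e2 : Equiv.swap k i * Equiv.swap i j = Equiv.swap i j * Equiv.swap j k := by
      ext a; simp only [Equiv.Perm.mul_apply, Equiv.swap_apply_def]; grind
    rw [e1, e2, Equiv.swap_apply_right, Equiv.swap_apply_right, Equiv.swap_apply_right,
      Equiv.swap_apply_of_ne_of_ne (Ne.symm h2) (Ne.symm h3),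
      Equiv.swap_apply_of_ne_of_ne h1 h2,
      Equiv.swap_apply_of_ne_of_ne h3 (Ne.symm h1),
      x_anti' n k i, x_anti' n i j, x_anti' n j k]
    simp only [map_smul, smul_mul_assoc, ← TensorProduct.smul_tmul']
    have f1 : (Lm n (x n i j * x n j k)) ⊗ₜ[ℚ] (1 : E n) + (Lm n (x n j k * x n k i)) ⊗ₜ[ℚ] 1
        + (Lm n (x n k i * x n i j)) ⊗ₜ[ℚ] 1 = 0 := by
      rw [← TensorProduct.add_tmul, ← TensorProduct.add_tmul, ← map_add, ← map_add, hc]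
      simp
    have f2 : ∀ g : Module.End ℚ (E n), g ⊗ₜ[ℚ] (x n i j * x n j k) +
        g ⊗ₜ[ℚ] (x n j k * x n k i) + g ⊗ₜ[ℚ] (x n k i * x n i j) = 0 := by
      intro g
      rw [← TensorProduct.tmul_add, ← TensorProduct.tmul_add, hc]
      simp
    have f3 := f2 (sg n (Equiv.swap i j * Equiv.swap j k))
    have g1 := add_ns ((Lm n (x n i j) * sg n (Equiv.swap j k)) ⊗ₜ[ℚ] x n j k)
    have g2 := add_ns ((Lm n (x n j k) * sg n (Equiv.swap k i)) ⊗ₜ[ℚ] x n k i)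
    have g3 := add_ns ((Lm n (x n k i) * sg n (Equiv.swap i j)) ⊗ₜ[ℚ] x n i j)
    exact shuffle f1 f3 g1 g2 g3

/-- The (bosonized) coproduct. -/
noncomputable def cop (n : ℕ) : E n →ₐ[ℚ] Module.End ℚ (E n) ⊗[ℚ] E n :=
  (exists_cop n).choose

lemma cop_x (n : ℕ) (i j : Fin n) : cop n (x n i j) = D n i j :=
  (exists_cop n).choose_spec i j

open Polynomial in
lemma exists_gr (n : ℕ) : ∃ F : E n →ₐ[ℚ] (E n)[X],
    ∀ i j, F (x n i j) = monomial 1 (x n i j) := by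
  apply exists_lift
  · intro i; simp [x_diag]
  · intro i j _; rw [x_anti n i j, ← map_add, neg_add_cancel, map_zero]
  · intro i j _; simp [monomial_mul_monomial, x_sq]
  · intro i j k l h; simp [monomial_mul_monomial, x_comm n i j k l h]
  · intro i j k h
    simp only [monomial_mul_monomial]
    rw [← map_add, ← map_add, x_cyc n i j k h, map_zero]

/-- The grading homomorphism. -/
noncomputable def gr (n : ℕ) : E n →ₐ[ℚ] Polynomial (E n) := (exists_gr n).choose

lemma gr_x (n : ℕ) (i j : Fin n) : gr n (x n i j) = Polynomial.monomial 1 (x n i j) :=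
  (exists_gr n).choose_spec i j

lemma word_nil (n : ℕ) : word n [] = 1 := by simp [word]

lemma word_cons (n : ℕ) (p : Fin n × Fin n) (l : List (Fin n × Fin n)) :
    word n (p :: l) = x n p.1 p.2 * word n l := by simp [word]

lemma word_append (n : ℕ) (l m : List (Fin n × Fin n)) :
    word n (l ++ m) = word n l * word n m := by simp [word]

lemma gr_word (n : ℕ) (l : List (Fin n × Fin n)) :
    gr n (word n l) = Polynomial.monomial l.length (word n l) := by
  induction l with
  | nil => simp [word_nil]
  | cons p l ih =>
    rw [word_cons, map_mul, gr_x, ih, Polynomial.monomial_mul_monomial, List.length_cons,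
      add_comm]

/-- Projection to degree `d`. -/
noncomputable def pr (n d : ℕ) : E n →ₗ[ℚ] E n where
  toFun y := (gr n y).coeff d
  map_add' := by simp
  map_smul' := by simp

lemma pr_word (n d : ℕ) (l : List (Fin n × Fin n)) :
    pr n d (word n l) = if l.length = d then word n l else 0 := by
  simp [pr, gr_word, Polynomial.coeff_monomial]

lemma pr_x_mul (n d : ℕ) (i j : Fin n) (y : E n) :
    pr n (d + 1) (x n i j * y) = x n i j * pr n d y := by
  simp only [pr, LinearMap.coe_mk, AddHom.coe_mk, map_mul, gr_x]
  rw [← Polynomial.C_mul_X_eq_monomial, mul_assoc, Polynomial.coeff_C_mul,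
    Polynomial.coeff_X_mul]

/-- Edge words of length `d`. -/
def W (n : ℕ) (G : SimpleGraph (Fin n)) (d : ℕ) : Submodule ℚ (E n) :=
  Submodule.span ℚ {y | ∃ l : List (Fin n × Fin n),
    (∀ p ∈ l, G.Adj p.1 p.2) ∧ l.length = d ∧ y = word n l}

lemma word_mem_EG {n : ℕ} {G : SimpleGraph (Fin n)} (l : List (Fin n × Fin n))
    (h : ∀ p ∈ l, G.Adj p.1 p.2) : word n l ∈ EG n G := by
  induction l with
  | nil => rw [word_nil]; exact one_mem _
  | cons p l ih =>
    rw [word_cons]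
    refine mul_mem (Algebra.subset_adjoin ⟨p.1, p.2, h p (by simp), rfl⟩)
      (ih fun q hq => h q (by simp [hq]))

lemma word_mem_EGdeg {n : ℕ} {G : SimpleGraph (Fin n)} (l : List (Fin n × Fin n))
    (h : ∀ p ∈ l, G.Adj p.1 p.2) : word n l ∈ EGdeg n G l.length :=
  ⟨word_mem_EG l h, Submodule.subset_span ⟨l, fun p hp => (h p hp).ne, rfl, rfl⟩⟩

lemma W_le {n : ℕ} {G : SimpleGraph (Fin n)} (d : ℕ) : W n G d ≤ EGdeg n G d := by
  apply Submodule.span_le.2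
  rintro y ⟨l, hl, rfl, rfl⟩
  exact word_mem_EGdeg l hl

lemma EG_span {n : ℕ} {G : SimpleGraph (Fin n)} {y : E n} (hy : y ∈ EG n G) :
    y ∈ Submodule.span ℚ {y | ∃ l : List (Fin n × Fin n),
      (∀ p ∈ l, G.Adj p.1 p.2) ∧ y = word n l} := by
  rw [EG, ← Subalgebra.mem_toSubmodule, Algebra.adjoin_eq_span] at hy
  refine Submodule.span_mono ?_ hy
  intro z hz
  induction hz using Submonoid.closure_induction with
  | mem z hz =>
    obtain ⟨i, j, h, rfl⟩ := hz
    exact ⟨[(i, j)], by simpa using h, by simp [word]⟩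
  | one => exact ⟨[], by simp, by simp [word]⟩
  | mul a b _ _ ha hb =>
    obtain ⟨l, hl, rfl⟩ := ha
    obtain ⟨m, hm, rfl⟩ := hb
    refine ⟨l ++ m, ?_, (word_append n l m).symm⟩
    intro p hp
    rcases List.mem_append.1 hp with h | h
    · exact hl p h
    · exact hm p h

lemma pr_mem_W {n : ℕ} {G : SimpleGraph (Fin n)} {y : E n} (hy : y ∈ EG n G) (d : ℕ) :
    pr n d y ∈ W n G d := by
  have hy' := EG_span hy
  clear hy
  induction hy' using Submodule.span_induction with
  | mem z hz =>
    obtain ⟨l, hl, rfl⟩ := hz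
    rw [pr_word]
    split_ifs with h
    · exact Submodule.subset_span ⟨l, hl, h, rfl⟩
    · exact zero_mem _
  | zero => simp
  | add a b _ _ ha hb => rw [map_add]; exact add_mem ha hb
  | smul c a _ ha => rw [map_smul]; exact Submodule.smul_mem _ _ ha

lemma eval_gr {n : ℕ} {G : SimpleGraph (Fin n)} {y : E n} (hy : y ∈ EG n G) :
    (gr n y).eval 1 = y := by
  have hy' := EG_span hy
  clear hy
  induction hy' using Submodule.span_induction with
  | mem z hz =>
    obtain ⟨l, hl, rfl⟩ := hz
    rw [gr_word]
    simp
  | zero => simp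
  | add a b _ _ ha hb => rw [map_add, Polynomial.eval_add, ha, hb]
  | smul c a _ ha => rw [map_smul, Polynomial.eval_smul, ha]

lemma pr_degSpan {n d : ℕ} {y : E n} (hy : y ∈ degSpan n d) : pr n d y = y := by
  induction hy using Submodule.span_induction with
  | mem z hz =>
    obtain ⟨l, hl, h, rfl⟩ := hz
    rw [pr_word, if_pos h]
  | zero => simp
  | add a b _ _ ha hb => rw [map_add, ha, hb]
  | smul c a _ ha => rw [map_smul, ha]

/-- Tensors whose second factor is an edge word of length between `1` and `d`. -/
def S (n : ℕ) (G : SimpleGraph (Fin n)) (d : ℕ) :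
    Submodule ℚ (Module.End ℚ (E n) ⊗[ℚ] E n) :=
  Submodule.span ℚ {y | ∃ (f : Module.End ℚ (E n)) (l : List (Fin n × Fin n)),
    (∀ p ∈ l, G.Adj p.1 p.2) ∧ 1 ≤ l.length ∧ l.length ≤ d ∧ y = f ⊗ₜ word n l}

lemma S_mul {n : ℕ} {G : SimpleGraph (Fin n)} {d : ℕ} (g : Module.End ℚ (E n))
    (m : List (Fin n × Fin n)) (hm : ∀ p ∈ m, G.Adj p.1 p.2)
    {e : ℕ} (he : m.length + d ≤ e)
    {s : Module.End ℚ (E n) ⊗[ℚ] E n} (hs : s ∈ S n G d) :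
    (g ⊗ₜ word n m) * s ∈ S n G e := by
  induction hs using Submodule.span_induction with
  | mem z hz =>
    obtain ⟨f, l, hl, h1, h2, rfl⟩ := hz
    rw [Algebra.TensorProduct.tmul_mul_tmul, ← word_append]
    refine Submodule.subset_span ⟨_, _, ?_, ?_, ?_, rfl⟩
    · intro p hp
      rcases List.mem_append.1 hp with h | h
      · exact hm p h
      · exact hl p h
    · simp; omega
    · simp; omega
  | zero => simp
  | add a b _ _ ha hb => rw [mul_add]; exact add_mem ha hb
  | smul c a _ ha => rw [mul_smul_comm]; exact Submodule.smul_mem _ _ ha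

lemma cop_word {n : ℕ} {G : SimpleGraph (Fin n)} (l : List (Fin n × Fin n))
    (h : ∀ p ∈ l, G.Adj p.1 p.2) :
    ∃ s ∈ S n G l.length, cop n (word n l) = Lm n (word n l) ⊗ₜ[ℚ] (1 : E n) + s := by
  induction l with
  | nil => exact ⟨0, zero_mem _, by
      have h1 : cop n 1 = (1 : Module.End ℚ (E n)) ⊗ₜ[ℚ] (1 : E n) := (cop n).map_one'
      rw [word_nil, h1, map_one, add_zero]⟩
  | cons p l ih =>
    have hp : G.Adj p.1 p.2 := h p (by simp)
    obtain ⟨s, ih, e⟩ := ih fun q hq => h q (by simp [hq])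
    have key : cop n (word n (p :: l)) = Lm n (word n (p :: l)) ⊗ₜ[ℚ] (1 : E n) +
        ((Lm n (x n p.1 p.2) ⊗ₜ[ℚ] word n []) * s
        + (sg n (Equiv.swap p.1 p.2) * Lm n (word n l)) ⊗ₜ[ℚ] word n [p]
        + (sg n (Equiv.swap p.1 p.2) ⊗ₜ[ℚ] word n [p]) * s) := by
      rw [word_cons, map_mul, e, cop_x, D, map_mul, word_cons n p [], word_nil]
      simp only [mul_add, add_mul, Algebra.TensorProduct.tmul_mul_tmul, mul_one]
      abel
    have h1 : ∀ q ∈ [p], G.Adj q.1 q.2 := by simpa using hp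
    refine ⟨_, ?_, key⟩
    refine add_mem (add_mem (S_mul _ _ (by simp) (by simp) ih) ?_)
      (S_mul _ _ h1 (by simp [add_comm]) ih)
    exact Submodule.subset_span ⟨_, [p], h1, by simp, by simp, rfl⟩

lemma cop_W {n d : ℕ} {G : SimpleGraph (Fin n)} {y : E n} (hy : y ∈ W n G d) :
    ∃ s ∈ S n G d, cop n y = Lm n y ⊗ₜ[ℚ] (1 : E n) + s := by
  induction hy using Submodule.span_induction with
  | mem z hz =>
    obtain ⟨l, hl, rfl, rfl⟩ := hz
    exact cop_word l hl
  | zero => exact ⟨0, zero_mem _, by simp⟩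
  | add a b _ _ ha hb =>
    obtain ⟨s, hs, ea⟩ := ha
    obtain ⟨t, ht, eb⟩ := hb
    refine ⟨s + t, add_mem hs ht, ?_⟩
    rw [map_add, map_add, TensorProduct.add_tmul, ea, eb]
    abel
  | smul c a _ ha =>
    obtain ⟨s, hs, ea⟩ := ha
    refine ⟨c • s, Submodule.smul_mem _ c hs, ?_⟩
    rw [map_smul, map_smul, ← TensorProduct.smul_tmul', ea, smul_add]

lemma transfer {n : ℕ} {G : SimpleGraph (Fin n)} {Q : E n}
    (hQ : ∀ i j, G.Adj i j → x n i j * Q = 0) (l : List (Fin n × Fin n))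
    (h : ∀ p ∈ l, G.Adj p.1 p.2) : ∃ g : Module.End ℚ (E n),
      (1 ⊗ₜ word n l) * cop n Q = (g ⊗ₜ 1) * cop n Q := by
  induction l with
  | nil => exact ⟨1, by rw [word_nil]⟩
  | cons p l ih =>
    obtain ⟨g, hg⟩ := ih fun q hq => h q (by simp [hq])
    have h0 : cop n (x n p.1 p.2 * Q) = 0 := by rw [hQ _ _ (h p (by simp)), map_zero]
    rw [map_mul, cop_x, D, add_mul] at h0
    have h1 := congrArg (fun z => (sg n (Equiv.swap p.1 p.2) ⊗ₜ[ℚ] (1 : E n)) * z) h0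
    simp only [mul_add, ← mul_assoc, Algebra.TensorProduct.tmul_mul_tmul, sg_mul,
      Equiv.swap_mul_self, sg_one, mul_one, one_mul, mul_zero] at h1
    refine ⟨g * ((-1 : ℚ) • (sg n (Equiv.swap p.1 p.2) * Lm n (x n p.1 p.2))), ?_⟩
    have a1 : (1 : Module.End ℚ (E n)) ⊗ₜ[ℚ] word n (p :: l) =
        (1 ⊗ₜ x n p.1 p.2) * (1 ⊗ₜ word n l) := by
      simp [word_cons]
    have a2 : ((1 : Module.End ℚ (E n)) ⊗ₜ[ℚ] x n p.1 p.2) * (g ⊗ₜ 1) =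
        (g ⊗ₜ 1) * (1 ⊗ₜ x n p.1 p.2) := by
      simp
    have a3 : ((1 : Module.End ℚ (E n)) ⊗ₜ[ℚ] x n p.1 p.2) * cop n Q =
        (((-1 : ℚ) • (sg n (Equiv.swap p.1 p.2) * Lm n (x n p.1 p.2))) ⊗ₜ[ℚ] (1 : E n)) * cop n Q := by
      have c1 : ((sg n (Equiv.swap p.1 p.2) * Lm n (x n p.1 p.2)) ⊗ₜ[ℚ] (1 : E n)) * cop n Q +
          (((-1 : ℚ) • (sg n (Equiv.swap p.1 p.2) * Lm n (x n p.1 p.2))) ⊗ₜ[ℚ] (1 : E n)) * cop n Q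
          = 0 := by
        rw [← add_mul, ← TensorProduct.add_tmul, add_ns, TensorProduct.zero_tmul,
          zero_mul]
      rw [← add_zero (((1 : Module.End ℚ (E n)) ⊗ₜ[ℚ] x n p.1 p.2) * cop n Q), ← c1,
        ← add_assoc, add_comm (((1 : Module.End ℚ (E n)) ⊗ₜ[ℚ] x n p.1 p.2) * cop n Q), h1,
        zero_add]
    rw [a1, mul_assoc, hg, ← mul_assoc, a2, mul_assoc, a3, ← mul_assoc,
      Algebra.TensorProduct.tmul_mul_tmul, mul_one]

/-- A homogeneous element killed by all edge generators lies in the top degree. -/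
lemma socle {n : ℕ} {G : SimpleGraph (Fin n)} {d₀ d : ℕ}
    (hmax : ∀ d : ℕ, d₀ < d → EGdeg n G d = ⊥) (hd : d < d₀)
    (T : List (Fin n × Fin n)) (hT : ∀ p ∈ T, G.Adj p.1 p.2) (hTl : T.length = d₀)
    (hT0 : word n T ≠ 0) {Q : E n} (hQ : Q ∈ W n G d)
    (hk : ∀ i j, G.Adj i j → x n i j * Q = 0) : Q = 0 := by
  obtain ⟨g, hg⟩ := transfer hk T hT
  obtain ⟨s, hs, e⟩ := cop_W hQ
  have hTs : ∀ s ∈ S n G d, ((1 : Module.End ℚ (E n)) ⊗ₜ[ℚ] word n T) * s = 0 := by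
    intro s hs
    induction hs using Submodule.span_induction with
    | mem z hz =>
      obtain ⟨f, l, hl, h1, h2, rfl⟩ := hz
      have h3 : word n (T ++ l) ∈ EGdeg n G (T ++ l).length := by
        apply word_mem_EGdeg
        intro p hp
        rcases List.mem_append.1 hp with h | h
        · exact hT p h
        · exact hl p h
      rw [hmax _ (by simp; omega), Submodule.mem_bot] at h3
      rw [Algebra.TensorProduct.tmul_mul_tmul, ← word_append, h3, TensorProduct.tmul_zero]
    | zero => simp
    | add a b _ _ ha hb => rw [mul_add, ha, hb, add_zero]
    | smul c a _ ha => rw [mul_smul_comm, ha, smul_zero]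
  have hP : ∀ s ∈ S n G d, (pr n d₀).lTensor (Module.End ℚ (E n)) s = 0 := by
    intro s hs
    induction hs using Submodule.span_induction with
    | mem z hz =>
      obtain ⟨f, l, hl, h1, h2, rfl⟩ := hz
      rw [LinearMap.lTensor_tmul, pr_word, if_neg (by omega), TensorProduct.tmul_zero]
    | zero => simp
    | add a b _ _ ha hb => rw [map_add, ha, hb, add_zero]
    | smul c a _ ha => rw [map_smul, ha, smul_zero]
  rw [e, mul_add, mul_add, hTs s hs, add_zero, Algebra.TensorProduct.tmul_mul_tmul,
    Algebra.TensorProduct.tmul_mul_tmul, one_mul, mul_one, mul_one] at hg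
  have h2 := congrArg ((pr n d₀).lTensor (Module.End ℚ (E n))) hg
  have hgs : (g ⊗ₜ[ℚ] (1 : E n)) * s ∈ S n G d := by
    have := S_mul (G := G) g [] (by simp) (e := d) (by simp) hs
    rwa [word_nil] at this
  have hone : pr n d₀ 1 = 0 := by
    have := pr_word n d₀ []
    rw [word_nil] at this
    rw [this, if_neg (by simp; omega)]
  rw [map_add, hP _ hgs, LinearMap.lTensor_tmul, LinearMap.lTensor_tmul, hone, pr_word,
    if_pos hTl, TensorProduct.tmul_zero, add_zero] at h2
  have h3 : Lm n Q = 0 := by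
    obtain ⟨φ, hφ⟩ := Module.Projective.exists_dual_eq_one ℚ hT0
    have h5 := congrArg (fun z => TensorProduct.rid ℚ _ (φ.lTensor (Module.End ℚ (E n)) z)) h2
    simpa [hφ] using h5
  have h4 := congrArg (fun f => f 1) h3
  simpa [Lm] using h4

/-- if `E_G` is finite-dimensional with top degree `d₀`, then for every
nonzero `Q ∈ E_G` there is a product `P` of generators `x_{ij}` (with `{i,j}` edges of `G`)
such that `PQ ≠ 0` and `PQ ∈ E_G^{d₀}`. -/
theorem stmt7 (n : ℕ) (hn : 1 ≤ n) (G : SimpleGraph (Fin n))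
    (hfd : FiniteDimensional ℚ ↥(EG n G)) (d₀ : ℕ)
    (h₀ : EGdeg n G d₀ ≠ ⊥) (hmax : ∀ d : ℕ, d₀ < d → EGdeg n G d = ⊥)
    (Q : E n) (hQ : Q ∈ EG n G) (hQ0 : Q ≠ 0) :
    ∃ l : List (Fin n × Fin n), (∀ p ∈ l, G.Adj p.1 p.2) ∧
      word n l * Q ≠ 0 ∧ word n l * Q ∈ EGdeg n G d₀ := by
  classical
  have hlen : ∀ l : List (Fin n × Fin n), (∀ p ∈ l, G.Adj p.1 p.2) → word n l ≠ 0 →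
      l.length ≤ d₀ := by
    intro l hl h0
    by_contra hc
    have := word_mem_EGdeg l hl
    rw [hmax _ (by omega), Submodule.mem_bot] at this
    exact h0 this
  -- a nonzero top word
  obtain ⟨T, hT, hTl, hT0⟩ : ∃ T : List (Fin n × Fin n), (∀ p ∈ T, G.Adj p.1 p.2) ∧
      T.length = d₀ ∧ word n T ≠ 0 := by
    by_contra hc
    push Not at hc
    apply h₀
    rw [eq_bot_iff]
    intro y hy
    have h1 := pr_mem_W (G := G) hy.1 d₀
    rw [pr_degSpan hy.2] at h1
    have h2 : W n G d₀ ≤ ⊥ := by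
      apply Submodule.span_le.2
      rintro z ⟨l, hl, hll, rfl⟩
      exact hc l hl hll
    exact h2 h1
  -- a longest word not killing `Q`
  let p : ℕ → Prop := fun k => ∃ l : List (Fin n × Fin n), (∀ p ∈ l, G.Adj p.1 p.2) ∧
    word n l * Q ≠ 0 ∧ l.length = k
  have hp0 : p 0 := ⟨[], by simp, by simpa [word_nil] using hQ0, rfl⟩
  have hpb : ∀ k, p k → k ≤ d₀ := by
    rintro k ⟨l, hl, h, rfl⟩
    exact hlen l hl (left_ne_zero_of_mul h)
  obtain ⟨l, hl, hlQ, hlk⟩ : p (Nat.findGreatest p d₀) :=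
    Nat.findGreatest_spec (Nat.zero_le _) hp0
  refine ⟨l, hl, hlQ, ?_⟩
  have hk : ∀ i j, G.Adj i j → x n i j * (word n l * Q) = 0 := by
    intro i j hij
    by_contra hne
    have h1 : p (l.length + 1) := by
      refine ⟨(i, j) :: l, ?_, ?_, by simp⟩
      · intro q hq
        rcases List.mem_cons.1 hq with rfl | hq
        · exact hij
        · exact hl q hq
      · rw [word_cons, mul_assoc]; exact hne
    have := Nat.le_findGreatest (hpb _ h1) h1
    omega
  have hmem : word n l * Q ∈ EG n G := mul_mem (word_mem_EG l hl) hQ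
  have hz : ∀ d, d ≠ d₀ → pr n d (word n l * Q) = 0 := by
    intro d hd
    rcases lt_or_gt_of_ne hd with h | h
    · apply socle hmax h T hT hTl hT0 (pr_mem_W hmem d)
      intro i j hij
      rw [← pr_x_mul, hk i j hij, map_zero]
    · have := W_le d (pr_mem_W hmem d)
      rwa [hmax d h, Submodule.mem_bot] at this
  have hg : gr n (word n l * Q) = Polynomial.monomial d₀ (pr n d₀ (word n l * Q)) := by
    ext d
    rw [Polynomial.coeff_monomial]
    split_ifs with h
    · subst h; rfl
    · exact hz d (Ne.symm h)
  have h1 := eval_gr hmem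
  rw [hg] at h1
  simp only [Polynomial.eval_monomial, one_pow, mul_one] at h1
  rw [← h1]
  exact W_le d₀ (pr_mem_W hmem d₀)

end FK
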